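/- arXiv:2604.10600 — 2 statements merged into one kernel-verified Lean document; each statement's English description precedes it below -/
import Mathlib

section
/- Let T̂ = {(x,y) ∈ ℝ² : x ≥ 0, y ≥ 0, x + y ≤ 1} be the reference triangle, let F : ℝ² → ℝ² be an invertible affine map and set K = F(T̂). Let â, b̂ be two distinct vertices of T̂ (so that the segment ê from â to b̂ is an edge of T̂), and let A = F(â), B = F(b̂), so that J = F(ê) is the corresponding edge of K. Then for every natural number p and every polynomial function P : ℝ² → ℝ of total degree at most p, the squared L²-norm of P on the edge J is bounded by 𝒢_K times the squared L²-norm of P on K, where 𝒢_K = ((p+1)(p+2)/2)·(length(J)/area(K)); explicitly, ‖A − B‖ · ∫₀¹ P(A + t(B − A))² dt ≤ ((p+1)(p+2)/2) · (‖A − B‖ / volume(K)) · ∫_K P(x)² dx, where volume denotes the two-dimensional Lebesgue measure. -/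
open MeasureTheory

namespace TraceTri
open Polynomial

lemma pInt (f : ℝ[X]) : IntervalIntegrable (fun x => f.eval x) volume 0 1 :=
  f.continuous.intervalIntegrable _ _

lemma ibp (f g : ℝ[X]) : ∫ x in (0:ℝ)..1, f.eval x * (derivative g).eval x =
    f.eval 1 * g.eval 1 - f.eval 0 * g.eval 0 -
      ∫ x in (0:ℝ)..1, (derivative f).eval x * g.eval x :=
  intervalIntegral.integral_mul_deriv_eq_deriv_mul
    (fun x _ => f.hasDerivAt x) (fun x _ => g.hasDerivAt x) (pInt _) (pInt _)

lemma orth (f : ℝ[X]) (n : ℕ) : ∀ q : ℝ[X], (∀ j < n, (derivative^[j] f).eval 0 = 0 ∧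
    (derivative^[j] f).eval 1 = 0) → q.degree < n →
    ∫ x in (0:ℝ)..1, q.eval x * (derivative^[n] f).eval x = 0 := by
  induction n with
  | zero =>
    intro q _ hq
    have : q = 0 := by
      rw [← Polynomial.degree_eq_bot]
      exact Nat.WithBot.lt_zero_iff.1 (by simpa using hq)
    simp [this]
  | succ n ih =>
    intro q hf hq
    rw [Function.iterate_succ_apply', ibp, (hf n (by omega)).1, (hf n (by omega)).2,
      ih (derivative q) (fun j hj => hf j (by omega))]
    · simp
    · rw [Polynomial.degree_lt_iff_coeff_zero] at hq ⊢
      intro m hm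
      rw [coeff_derivative, hq (m+1) (by exact_mod_cast Nat.succ_le_succ hm), zero_mul]

/-- real shifted Legendre -/
noncomputable def L (n : ℕ) : ℝ[X] := (shiftedLegendre n).map (Int.castRingHom ℝ)

lemma L_orth (n : ℕ) (q : ℝ[X]) (hq : q.degree < n) :
    ∫ x in (0:ℝ)..1, q.eval x * (L n).eval x = 0 := by
  have hr : derivative^[n] (X ^ n * (1 - (X : ℝ[X])) ^ n) = C (n.factorial : ℝ) * L n := by
    have := congrArg (Polynomial.map (Int.castRingHom ℝ)) (factorial_mul_shiftedLegendre_eq n)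
    rw [← Polynomial.iterate_derivative_map] at this
    simp at this
    rw [← this, L]
    simp
  have h := orth (X ^ n * (1 - (X : ℝ[X])) ^ n) n q (by
    intro j hj
    constructor
    · have h1 : X ^ (n - j) ∣ derivative^[j] (X ^ n * (1 - (X : ℝ[X])) ^ n) :=
        pow_sub_dvd_iterate_derivative_of_pow_dvd j (Dvd.intro _ rfl)
      obtain ⟨r, hr⟩ := h1
      rw [hr]
      simp [Nat.sub_ne_zero_of_lt hj]
    · have h1 : (1 - X) ^ (n - j) ∣ derivative^[j] (X ^ n * (1 - (X : ℝ[X])) ^ n) :=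
        pow_sub_dvd_iterate_derivative_of_pow_dvd j (Dvd.intro_left _ rfl)
      obtain ⟨r, hr⟩ := h1
      rw [hr]
      simp [Nat.sub_ne_zero_of_lt hj]) hq
  rw [hr] at h
  have hn : (n.factorial : ℝ) ≠ 0 := by positivity
  have : ∀ x : ℝ, q.eval x * (C (n.factorial : ℝ) * L n).eval x =
      n.factorial * (q.eval x * (L n).eval x) := by
    intro x; rw [eval_mul, eval_C]; ring
  simp_rw [this, intervalIntegral.integral_const_mul] at h
  exact (mul_eq_zero.1 h).resolve_left hn

lemma L_zero (n : ℕ) : (L n).eval 0 = 1 := by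
  rw [← coeff_zero_eq_eval_zero, L, coeff_map, coeff_shiftedLegendre]; simp

lemma L_deriv_zero (n : ℕ) : (derivative (L n)).eval 0 = -(n * (n + 1)) := by
  rw [← coeff_zero_eq_eval_zero, coeff_derivative, L, coeff_map, coeff_shiftedLegendre]; simp

lemma L_deg (n : ℕ) : (L n).natDegree ≤ n := by
  refine (natDegree_map_le).trans ?_
  simp

lemma reprod (p : ℕ) (g : ℝ[X]) (hg : g.natDegree ≤ p) :
    ∫ x in (0:ℝ)..1, ((1 - X) * g).eval x * (derivative (L (p+1))).eval x = - g.eval 0 := by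
  rw [ibp, L_orth]
  · simp [L_zero]
  · refine lt_of_le_of_lt degree_le_natDegree ?_
    have h1 : ((1 - X) * g).natDegree ≤ 1 + p := natDegree_mul_le.trans
      (add_le_add ((natDegree_sub_le _ _).trans (by simp)) hg)
    have := natDegree_derivative_le ((1 - X) * g)
    exact_mod_cast (show _ < p + 1 by omega)

lemma oneD (p : ℕ) (g : ℝ[X]) (hg : g.natDegree ≤ p) :
    (g.eval 0) ^ 2 ≤ ((p : ℝ) + 1) * (p + 2) * ∫ x in (0:ℝ)..1, (1 - x) * (g.eval x) ^ 2 := by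
  set k := derivative (L (p+1)) with hk
  have hkd : k.natDegree ≤ p := by
    have h1 := natDegree_derivative_le (L (p+1)); have h2 := L_deg (p+1); rw [← hk] at h1; omega
  have hk0 : k.eval 0 = -(((p : ℝ) + 1) * (p + 2)) := by
    rw [hk, L_deriv_zero]; push_cast; ring
  set c : ℝ := ((p : ℝ) + 1) * (p + 2) with hc
  have hcpos : 0 < c := by positivity
  set a := g.eval 0 with ha
  have h1 := reprod p g hg
  have h2 := reprod p k hkd
  rw [← hk] at h1 h2
  rw [hk0] at h2
  have h0 : 0 ≤ ∫ x in (0:ℝ)..1, (1 - x) * (c * g.eval x + a * k.eval x) ^ 2 := by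
    apply intervalIntegral.integral_nonneg zero_le_one
    intro x hx
    exact mul_nonneg (by linarith [hx.2]) (sq_nonneg _)
  have e : ∀ x : ℝ, (1 - x) * (c * g.eval x + a * k.eval x) ^ 2 =
     c ^ 2 * ((1 - x) * (g.eval x)^2) + (2 * c * a) * (((1 - X) * g).eval x * k.eval x)
      + a ^ 2 * (((1 - X) * k).eval x * k.eval x) := by
    intro x; simp; ring
  simp_rw [e] at h0
  rw [intervalIntegral.integral_add, intervalIntegral.integral_add,
    intervalIntegral.integral_const_mul, intervalIntegral.integral_const_mul,
    intervalIntegral.integral_const_mul, h1, h2] at h0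
  · have : 0 ≤ c * (c * (∫ x in (0:ℝ)..1, (1 - x) * (g.eval x) ^ 2) - a ^ 2) := by
      rw [← ha] at h0
      linarith
    have := nonneg_of_mul_nonneg_right this hcpos
    linarith
  all_goals
    apply Continuous.intervalIntegrable
    fun_prop

abbrev E2 := EuclideanSpace ℝ (Fin 2)

def T : Set E2 := {x : EuclideanSpace ℝ (Fin 2) | 0 ≤ x 0 ∧ 0 ≤ x 1 ∧ x 0 + x 1 ≤ 1}

lemma T_meas : MeasurableSet T := by
  apply IsClosed.measurableSet
  have h1 : IsClosed {x : E2 | 0 ≤ x 0} := isClosed_le (by fun_prop) (by fun_prop)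
  have h2 : IsClosed {x : E2 | 0 ≤ x 1} := isClosed_le (by fun_prop) (by fun_prop)
  have h3 : IsClosed {x : E2 | x 0 + x 1 ≤ 1} := isClosed_le (by fun_prop) (by fun_prop)
  exact h1.inter (h2.inter h3)

lemma inner_sub (y : ℝ) (hy : y ∈ Set.Icc (0:ℝ) 1) (f : ℝ → ℝ) :
    ∫ x, Set.indicator {x : ℝ | 0 ≤ x ∧ 0 ≤ y ∧ x + y ≤ 1} f x =
      ∫ s in (0:ℝ)..1, (1 - y) * f (s * (1 - y)) := by
  have : {x : ℝ | 0 ≤ x ∧ 0 ≤ y ∧ x + y ≤ 1} = Set.Icc 0 (1 - y) := by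
    ext x; simp only [Set.mem_ofPred_eq, Set.mem_Icc]
    constructor
    · rintro ⟨h1, h2, h3⟩; exact ⟨h1, by linarith⟩
    · rintro ⟨h1, h2⟩; exact ⟨h1, hy.1, by linarith⟩
  rw [this, integral_indicator measurableSet_Icc, integral_Icc_eq_integral_Ioc,
    ← intervalIntegral.integral_of_le (by linarith [hy.2]), intervalIntegral.integral_const_mul,
    intervalIntegral.mul_integral_comp_mul_right]
  simp

lemma duffy (h : ℝ × ℝ → ℝ) (hc : Continuous h) :
    ∫ x in T, h (x 0, x 1) =
      ∫ s in (0:ℝ)..1, ∫ y in (0:ℝ)..1, (1 - y) * h (s * (1 - y), y) := by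
  set S : Set (ℝ × ℝ) := {z | 0 ≤ z.1 ∧ 0 ≤ z.2 ∧ z.1 + z.2 ≤ 1} with hS
  have hScl : IsClosed S := by
    have h1 : IsClosed {x : ℝ × ℝ | 0 ≤ x.1} := isClosed_le (by fun_prop) (by fun_prop)
    have h2 : IsClosed {x : ℝ × ℝ | 0 ≤ x.2} := isClosed_le (by fun_prop) (by fun_prop)
    have h3 : IsClosed {x : ℝ × ℝ | x.1 + x.2 ≤ 1} := isClosed_le (by fun_prop) (by fun_prop)
    exact h1.inter (h2.inter h3)
  have hSm : MeasurableSet S := hScl.measurableSet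
  have hSc : IsCompact S := by
    apply IsCompact.of_isClosed_subset (isCompact_Icc (a := ((0:ℝ), (0:ℝ))) (b := ((1:ℝ), (1:ℝ)))) hScl
    rintro ⟨a, b⟩ ⟨h1, h2, h3⟩
    simp only at h1 h2 h3
    exact ⟨⟨h1, h2⟩, ⟨by simp only; linarith, by simp only; linarith⟩⟩
  have mp : MeasurePreserving (fun x : E2 => (x 0, x 1)) volume (volume : Measure (ℝ × ℝ)) :=
    (volume_preserving_finTwoArrow ℝ).comp
      (EuclideanSpace.volume_preserving_symm_measurableEquiv_toLp (Fin 2))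
  have emb : MeasurableEmbedding (fun x : E2 => (x 0, x 1)) :=
    (MeasurableEquiv.finTwoArrow (α := ℝ)).measurableEmbedding.comp
      (MeasurableEquiv.toLp 2 (Fin 2 → ℝ)).symm.measurableEmbedding
  have e1 : ∫ x in T, h (x 0, x 1) = ∫ z in S, h z := mp.setIntegral_preimage_emb emb h S
  have hint : Integrable (S.indicator h) (volume.prod volume) :=
    (integrable_indicator_iff hSm).2 (hc.continuousOn.integrableOn_compact hSc)
  rw [e1, ← integral_indicator hSm, Measure.volume_eq_prod, integral_prod_symm _ hint]
  have e2 : ∀ y : ℝ, ∫ x, S.indicator h (x, y) = Set.indicator (Set.Icc (0:ℝ) 1)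
      (fun y => ∫ s in (0:ℝ)..1, (1 - y) * h (s * (1 - y), y)) y := by
    intro y
    by_cases hy : y ∈ Set.Icc (0:ℝ) 1
    · rw [Set.indicator_of_mem hy, ← inner_sub y hy (fun x => h (x, y))]
      rfl
    · rw [Set.indicator_of_notMem hy]
      have : ∀ x, S.indicator h (x, y) = 0 := by
        intro x
        apply Set.indicator_of_notMem
        rintro ⟨h1, h2, h3⟩
        simp only at h1 h2 h3
        exact hy ⟨h2, by linarith⟩
      simp [this]
  simp_rw [e2]
  rw [integral_indicator measurableSet_Icc, integral_Icc_eq_integral_Ioc,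
    ← intervalIntegral.integral_of_le zero_le_one]
  simp only [intervalIntegral.integral_of_le zero_le_one]
  apply integral_integral_swap
  rw [Measure.prod_restrict]
  refine IntegrableOn.mono_set (t := Set.Icc 0 1 ×ˢ Set.Icc 0 1) ?_
    (Set.prod_mono Set.Ioc_subset_Icc_self Set.Ioc_subset_Icc_self)
  apply ContinuousOn.integrableOn_compact (isCompact_Icc.prod isCompact_Icc)
  apply Continuous.continuousOn
  simp only [Function.uncurry_def]
  fun_prop

lemma vol_T : ∫ x in T, (1:ℝ) = 1 / 2 := by
  rw [duffy (fun _ => 1) continuous_const]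
  have : ∫ y in (0:ℝ)..1, (1 - y) = 1 / 2 := by
    rw [intervalIntegral.integral_sub (by simp) (by simp)]
    norm_num
  simp [this]

lemma image_int (F : E2 ≃ᵃ[ℝ] E2) : ∃ d : ℝ, 0 < d ∧ ∀ g : E2 → ℝ,
    ∫ x in F '' T, g x = d * ∫ x in T, g (F x) := by
  let F' : E2 ≃L[ℝ] E2 := F.linear.toContinuousLinearEquiv
  refine ⟨|(F' : E2 →L[ℝ] E2).det|, ?_, fun g => ?_⟩
  · rw [abs_pos]
    exact F'.toLinearEquiv.isUnit_det'.ne_zero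
  · rw [integral_image_eq_integral_abs_det_fderiv_smul volume T_meas
      (f := F) (f' := fun _ => (F' : E2 →L[ℝ] E2)) ?_ F.injective.injOn]
    · simp only [smul_eq_mul]
      rw [integral_const_mul]
    · intro x _
      have : (F : E2 → E2) = fun x => F' x + F 0 := by
        ext1 x
        have := F.map_vadd 0 x
        simp only [vadd_eq_add, add_zero] at this
        exact this
      rw [this]
      exact ((F' : E2 →L[ℝ] E2).hasFDerivAt.add_const _).hasFDerivWithinAt

lemma line_poly (a b : E2) (p : ℕ) (Q : MvPolynomial (Fin 2) ℝ) (hQ : Q.totalDegree ≤ p) :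
    ∃ g : ℝ[X], g.natDegree ≤ p ∧ ∀ y : ℝ,
      g.eval y = MvPolynomial.eval (fun i => (a + y • b) i) Q := by
  refine ⟨MvPolynomial.aeval (fun i => C (b i) * X + C (a i)) Q, ?_, fun y => ?_⟩
  · simpa using MvPolynomial.aeval_natDegree_le Q hQ (fun i => C (b i) * X + C (a i))
      (fun i => natDegree_linear_le)
  · rw [← Polynomial.coe_evalRingHom, MvPolynomial.aeval_def, MvPolynomial.hom_eval₂,
      MvPolynomial.eval, MvPolynomial.coe_eval₂Hom]
    congr 1
    · ext; simp
    · ext i; simp; ring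

def Claim (va vb : E2) (p : ℕ) (Q : MvPolynomial (Fin 2) ℝ) : Prop :=
  ∀ F : E2 ≃ᵃ[ℝ] E2,
    ‖F va - F vb‖ *
        ∫ t in (0 : ℝ)..1,
          (MvPolynomial.eval (fun i => (F va + t • (F vb - F va)) i) Q) ^ 2 ≤
      (((p : ℝ) + 1) * ((p : ℝ) + 2) / 2) *
          (‖F va - F vb‖ / (volume (F '' T)).toReal) *
        ∫ x in F '' T, (MvPolynomial.eval (fun i => x i) Q) ^ 2

lemma core (p : ℕ) (Q : MvPolynomial (Fin 2) ℝ) (hQ : Q.totalDegree ≤ p) :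
    Claim !₂[0, 0] !₂[1, 0] p Q := by
  intro F
  obtain ⟨d, hd, hF⟩ := image_int F
  have hvol : (volume (F '' T)).toReal = d * (1 / 2) := by
    rw [← vol_T, ← hF (fun _ => 1)]; simp [Measure.real]
  have hFc : Continuous F := F.continuous_of_finiteDimensional
  set H : ℝ × ℝ → ℝ := fun z => (MvPolynomial.eval (fun i => (F !₂[z.1, z.2]) i) Q) ^ 2 with hH
  have hHc : Continuous H := by
    apply Continuous.pow
    apply (MvPolynomial.continuous_eval Q).comp
    apply continuous_pi
    intro i
    have : Continuous fun z : ℝ × ℝ => F !₂[z.1, z.2] := hFc.comp (by fun_prop)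
    fun_prop
  have hK : ∫ x in F '' T, (MvPolynomial.eval (fun i => x i) Q) ^ 2 =
      d * ∫ s in (0:ℝ)..1, ∫ y in (0:ℝ)..1, (1 - y) * H (s * (1 - y), y) := by
    rw [hF, ← duffy H hHc]
    congr 2
    ext x
    have : !₂[x 0, x 1] = x := by ext i; fin_cases i <;> rfl
    simp only [hH, this]
  have hlin : ∀ a v : E2, ∀ t : ℝ, F (a + t • v) = F a + t • F.linear v := by
    intro a v t
    have := F.map_vadd a (t • v)
    simp only [vadd_eq_add, map_smul] at this
    rw [add_comm a, this, add_comm]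
  have hJ : ∀ t : ℝ, (MvPolynomial.eval (fun i => (F !₂[0, 0] + t • (F !₂[1, 0] - F !₂[0, 0])) i) Q) ^ 2
      = H (t, 0) := by
    intro t
    have h1 := hlin !₂[0, 0] !₂[1, 0] 1
    have h2 := hlin !₂[0, 0] !₂[1, 0] t
    have e1 : (!₂[0, 0] + (1:ℝ) • !₂[1, 0] : E2) = !₂[1, 0] := by
      ext i; fin_cases i <;> simp
    have e2 : (!₂[0, 0] + t • !₂[1, 0] : E2) = !₂[t, 0] := by
      ext i; fin_cases i <;> simp
    rw [e1] at h1
    rw [e2] at h2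
    simp only [hH]
    rw [h2, h1]
    simp
  have key : ∀ s : ℝ, H (s, 0) ≤ ((p : ℝ) + 1) * (p + 2) *
      ∫ y in (0:ℝ)..1, (1 - y) * H (s * (1 - y), y) := by
    intro s
    obtain ⟨g, hg, hge⟩ := line_poly (F !₂[s, 0]) (F.linear !₂[-s, 1]) p Q hQ
    have h1 : ∀ y, H (s * (1 - y), y) = (g.eval y) ^ 2 := by
      intro y
      rw [hge, ← hlin]
      have : (!₂[s, 0] + y • !₂[-s, 1] : E2) = !₂[s * (1 - y), y] := by
        ext i; fin_cases i <;> simp; ring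
      rw [this]
    have h0 := h1 0
    simp only [sub_zero, mul_one] at h0
    simp_rw [h1, h0]
    exact oneD p g hg
  simp_rw [hJ]
  rw [hK, hvol]
  have hmono : ∫ t in (0:ℝ)..1, H (t, 0) ≤ ((p : ℝ) + 1) * (p + 2) *
      ∫ s in (0:ℝ)..1, ∫ y in (0:ℝ)..1, (1 - y) * H (s * (1 - y), y) := by
    rw [← intervalIntegral.integral_const_mul]
    apply intervalIntegral.integral_mono_on zero_le_one
    · apply Continuous.intervalIntegrable; fun_prop
    · apply Continuous.intervalIntegrable
      apply Continuous.mul continuous_const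
      apply intervalIntegral.continuous_parametric_intervalIntegral_of_continuous'
      simp only [Function.uncurry_def]
      fun_prop
    · intro s _; exact key s
  calc _ ≤ _ := mul_le_mul_of_nonneg_left hmono (norm_nonneg _)
    _ = _ := by field_simp

lemma claim_trans (G : E2 ≃ᵃ[ℝ] E2) (hG : G '' T = T) {va vb : E2} {p : ℕ}
    {Q : MvPolynomial (Fin 2) ℝ} (h : Claim va vb p Q) : Claim (G va) (G vb) p Q := by
  intro F
  have := h (G.trans F)
  have e : (G.trans F) '' T = F '' T := by
    rw [AffineEquiv.coe_trans, Set.image_comp, hG]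
  rw [e] at this
  exact this

lemma image_invol {f : E2 → E2} (h1 : ∀ x, f (f x) = x) (h2 : ∀ x ∈ T, f x ∈ T) :
    f '' T = T := by
  apply Set.Subset.antisymm
  · rintro _ ⟨x, hx, rfl⟩; exact h2 x hx
  · intro x hx; exact ⟨f x, h2 x hx, h1 x⟩

/-- swap of coordinates -/
noncomputable def sw : E2 ≃ₗ[ℝ] E2 :=
  LinearEquiv.ofInvolutive
    { toFun := fun x => !₂[x 1, x 0]
      map_add' := by intro x y; ext i; fin_cases i <;> simp
      map_smul' := by intro c x; ext i; fin_cases i <;> simp }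
    (by intro x; ext i; fin_cases i <;> simp)

/-- linear part of the map exchanging the vertices on the bottom edge -/
noncomputable def tl : E2 ≃ₗ[ℝ] E2 :=
  LinearEquiv.ofInvolutive
    { toFun := fun x => !₂[- x 0 - x 1, x 1]
      map_add' := by intro x y; ext i; fin_cases i <;> simp; ring
      map_smul' := by intro c x; ext i; fin_cases i <;> simp; ring }
    (by intro x; ext i; fin_cases i <;> simp)

noncomputable def ta : E2 ≃ᵃ[ℝ] E2 :=
  tl.toAffineEquiv.trans (AffineEquiv.constVAdd ℝ E2 !₂[1, 0])

lemma sw_apply (a b : ℝ) : sw.toAffineEquiv !₂[a, b] = !₂[b, a] := rfl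

lemma ta_apply (a b : ℝ) : ta !₂[a, b] = !₂[1 - a - b, b] := by
  have : ta !₂[a, b] = !₂[1, 0] + !₂[-a-b, b] := rfl
  rw [this]; ext i; fin_cases i <;> simp; ring

lemma eta (x : E2) : x = !₂[x 0, x 1] := by ext i; fin_cases i <;> rfl

lemma claim_sw {a b c d : ℝ} {p : ℕ} {Q : MvPolynomial (Fin 2) ℝ}
    (h : Claim !₂[a, b] !₂[c, d] p Q) : Claim !₂[b, a] !₂[d, c] p Q := by
  have := claim_trans sw.toAffineEquiv (image_invol ?_ ?_) h
  · simpa only [sw_apply] using this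
  · intro x; rw [eta x, sw_apply, sw_apply]
  · intro x; rw [eta x, sw_apply]
    rintro ⟨h1, h2, h3⟩
    exact ⟨h2, h1, by simp at h3 ⊢; linarith⟩

lemma claim_ta {a b c d : ℝ} {p : ℕ} {Q : MvPolynomial (Fin 2) ℝ}
    (h : Claim !₂[a, b] !₂[c, d] p Q) : Claim !₂[1 - a - b, b] !₂[1 - c - d, d] p Q := by
  have := claim_trans ta (image_invol ?_ ?_) h
  · simpa only [ta_apply] using this
  · intro x; rw [eta x, ta_apply, ta_apply]; congr 2; ring_nf
  · intro x; rw [eta x, ta_apply]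
    rintro ⟨h1, h2, h3⟩
    simp at h1 h2 h3
    refine ⟨?_, ?_, ?_⟩ <;> simp <;> linarith

lemma all_claims (va vb : E2)
    (hva : (va 0, va 1) ∈ ({(0, 0), (1, 0), (0, 1)} : Set (ℝ × ℝ)))
    (hvb : (vb 0, vb 1) ∈ ({(0, 0), (1, 0), (0, 1)} : Set (ℝ × ℝ)))
    (hne : va ≠ vb) (p : ℕ) (Q : MvPolynomial (Fin 2) ℝ) (hQ : Q.totalDegree ≤ p) :
    Claim va vb p Q := by
  have c1 := core p Q hQ
  have c2 := claim_ta c1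
  have c3 := claim_sw c1
  have c4 := claim_sw c2
  have c5 := claim_ta c3
  have c6 := claim_ta c4
  norm_num at c1 c2 c3 c4 c5 c6
  rw [eta va, eta vb] at hne ⊢
  simp only [Set.mem_insert_iff, Set.mem_singleton_iff, Prod.mk.injEq] at hva hvb
  rcases hva with ⟨h1, h2⟩ | ⟨h1, h2⟩ | ⟨h1, h2⟩ <;>
  rcases hvb with ⟨h3, h4⟩ | ⟨h3, h4⟩ | ⟨h3, h4⟩ <;>
  rw [h1, h2, h3, h4] at hne ⊢ <;> first | assumption | exact absurd rfl hne

end TraceTri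

/-- Polynomial trace inequality on an affine image of the reference triangle
`T̂ = {(x,y) : 0 ≤ x, 0 ≤ y, x + y ≤ 1}`: for a polynomial `P` of total degree at most `p`,
the squared `L²` norm of `P` on an edge `J = F(ê)` of `K = F(T̂)` is bounded by
`𝒢_K = ((p+1)(p+2)/2)·(length J / area K)` times the squared `L²` norm of `P` on `K`. -/
theorem polynomial_trace_inequality_triangle
    (F : EuclideanSpace ℝ (Fin 2) ≃ᵃ[ℝ] EuclideanSpace ℝ (Fin 2))
    (va vb : EuclideanSpace ℝ (Fin 2))
    (hva : (va 0, va 1) ∈ ({(0, 0), (1, 0), (0, 1)} : Set (ℝ × ℝ)))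
    (hvb : (vb 0, vb 1) ∈ ({(0, 0), (1, 0), (0, 1)} : Set (ℝ × ℝ)))
    (hne : va ≠ vb)
    (p : ℕ) (Q : MvPolynomial (Fin 2) ℝ) (hQ : Q.totalDegree ≤ p) :
    ‖F va - F vb‖ *
        ∫ t in (0 : ℝ)..1,
          (MvPolynomial.eval (fun i => (F va + t • (F vb - F va)) i) Q) ^ 2 ≤
      (((p : ℝ) + 1) * ((p : ℝ) + 2) / 2) *
          (‖F va - F vb‖ /
            (volume (F '' {x : EuclideanSpace ℝ (Fin 2) |
              0 ≤ x 0 ∧ 0 ≤ x 1 ∧ x 0 + x 1 ≤ 1})).toReal) *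
        ∫ x in F '' {x : EuclideanSpace ℝ (Fin 2) | 0 ≤ x 0 ∧ 0 ≤ x 1 ∧ x 0 + x 1 ≤ 1},
          (MvPolynomial.eval (fun i => x i) Q) ^ 2 := by
  exact TraceTri.all_claims va vb hva hvb hne p Q hQ F
end

section
/- Let I = (a,b) be a bounded open interval with a < b and h = b − a. Then for every natural number p ≥ 1, every real q with 1 ≤ q < ∞, and every real polynomial φ of degree at most p, one has sup_{x ∈ [a,b]} |φ(x)| ≤ 2 · (8/h)^{1/q} · p^{2/q} · (∫_a^b |φ(x)|^q dx)^{1/q}. -/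
open Polynomial in
lemma endpoint_markov (p : ℕ) (φ : Polynomial ℝ) (hφ : φ.natDegree ≤ p) (c x M : ℝ)
    (hM : 0 < M) (hbd : ∀ y ∈ Set.uIcc c x, |φ.eval y| ≤ M) :
    |x - c| * |(derivative φ).eval x| ≤ 2 * (p : ℝ) ^ 2 * M := by
  have key : ∀ e : ℝ, |e| = M⁻¹ → e * ((x - c) / 2 * (derivative φ).eval x) ≤ (p : ℝ) ^ 2 := by
    intro e he
    set L : ℝ[X] := C ((x - c) / 2) * X + C ((c + x) / 2) with hL
    set P : ℝ[X] := C e * φ.comp L with hP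
    have hLd : L.natDegree ≤ 1 := natDegree_linear_le
    have hdeg : P.degree ≤ p := by
      apply degree_le_of_natDegree_le
      calc P.natDegree ≤ (φ.comp L).natDegree := natDegree_C_mul_le _ _
        _ ≤ φ.natDegree * L.natDegree := natDegree_comp_le
        _ ≤ p * 1 := Nat.mul_le_mul hφ hLd
        _ = p := mul_one p
    have hb : ∀ t ∈ Set.Icc (-1 : ℝ) 1, |P.eval t| ≤ 1 := by
      intro t ht
      have hmem : (x - c) / 2 * t + (c + x) / 2 ∈ Set.uIcc c x := by
        rw [Set.mem_uIcc]
        rcases le_total c x with h | h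
        · left
          constructor <;> nlinarith [ht.1, ht.2]
        · right
          constructor <;> nlinarith [ht.1, ht.2]
      have h1 := hbd _ hmem
      simp only [hP, hL, eval_mul, eval_C, eval_comp, eval_add, eval_X, abs_mul, he]
      calc _ ≤ M⁻¹ * M := by gcongr
        _ = 1 := inv_mul_cancel₀ hM.ne'
    have h := Chebyshev.eval_iterate_derivative_le_of_forall_abs_le_one (k := 1) (le_refl 1) hdeg hb
    simp only [Function.iterate_one, Chebyshev.derivative_T_eval_one] at h
    have h2 : (derivative P).eval 1 = e * ((x - c) / 2 * (derivative φ).eval x) := by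
      have : (x - c) / 2 + (c + x) / 2 = x := by ring
      simp [hP, hL, derivative_comp, this]
    rw [h2] at h
    exact_mod_cast h
  have h1 := key M⁻¹ (abs_of_pos (inv_pos.mpr hM))
  have h2 := key (-M⁻¹) (by rw [abs_neg, abs_of_pos (inv_pos.mpr hM)])
  have h3 : |M⁻¹ * ((x - c) / 2 * (derivative φ).eval x)| ≤ (p : ℝ) ^ 2 := by
    rw [abs_le]; constructor <;> linarith
  rw [abs_mul, abs_mul, abs_of_pos (inv_pos.mpr hM), abs_div, abs_two,
    inv_mul_le_iff₀ hM] at h3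
  linarith

/-- Nikolskii-type inverse inequality for polynomials on a bounded interval `I = (a,b)`
with `h = b - a`: for a real polynomial `φ` of degree at most `p ≥ 1` and `1 ≤ q < ∞`,
`sup_{x ∈ [a,b]} |φ(x)| ≤ 2 (8/h)^{1/q} p^{2/q} ‖φ‖_{L^q(a,b)}`. -/
theorem polynomial_inverse_inequality (a b : ℝ) (hab : a < b)
    (p : ℕ) (hp : 1 ≤ p) (q : ℝ) (hq : 1 ≤ q)
    (φ : Polynomial ℝ) (hφ : φ.natDegree ≤ p) :
    sSup ((fun x => |φ.eval x|) '' Set.Icc a b) ≤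
      2 * (8 / (b - a)) ^ (1 / q) * (p : ℝ) ^ (2 / q) *
        (∫ x in a..b, |φ.eval x| ^ q) ^ (1 / q) := by
  have hq0 : 0 < q := by linarith
  have hh : 0 < b - a := sub_pos.mpr hab
  have hp1 : (1 : ℝ) ≤ p := by exact_mod_cast hp
  have hp2 : (1 : ℝ) ≤ (p : ℝ) ^ 2 := one_le_pow₀ hp1
  have hcont : Continuous (fun x => |φ.eval x|) := φ.continuous.abs
  obtain ⟨x₀, hx₀, hmax⟩ := isCompact_Icc.exists_isMaxOn
    (Set.nonempty_Icc.mpr hab.le) hcont.continuousOn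
  set M := |φ.eval x₀| with hMdef
  have hle : ∀ y ∈ Set.Icc a b, |φ.eval y| ≤ M := fun y hy => hmax hy
  have hint0 : 0 ≤ ∫ x in a..b, |φ.eval x| ^ q :=
    intervalIntegral.integral_nonneg hab.le (fun x _ => by positivity)
  apply csSup_le ((Set.nonempty_Icc.mpr hab.le).image _)
  rintro _ ⟨y, hy, rfl⟩
  refine (hle y hy).trans ?_
  have hM0 : 0 ≤ M := abs_nonneg _
  rcases hM0.eq_or_lt with hM | hM
  · rw [← hM]; positivity
  -- derivative bound
  have hder : ∀ y ∈ Set.Icc a b, ‖φ.derivative.eval y‖ ≤ 4 * (p : ℝ) ^ 2 * M / (b - a) := by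
    intro y hy
    rw [Real.norm_eq_abs, le_div_iff₀ hh]
    rcases le_total ((a + b) / 2) y with h | h
    · have := endpoint_markov p φ hφ a y M hM (fun z hz => hle z (by
        rw [Set.uIcc_of_le hy.1] at hz
        exact ⟨hz.1, hz.2.trans hy.2⟩))
      rw [abs_of_nonneg (by linarith [hy.1])] at this
      nlinarith [abs_nonneg (φ.derivative.eval y)]
    · have := endpoint_markov p φ hφ b y M hM (fun z hz => hle z (by
        rw [Set.uIcc_of_ge hy.2] at hz
        exact ⟨hy.1.trans hz.1, hz.2⟩))
      rw [abs_of_nonpos (by linarith [hy.2])] at this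
      nlinarith [abs_nonneg (φ.derivative.eval y)]
  set δ := (b - a) / (8 * (p : ℝ) ^ 2) with hδ
  have hδ0 : 0 < δ := by positivity
  have hδ2 : δ ≤ (b - a) / 2 := by
    rw [hδ]; gcongr; linarith
  have hKδ : 4 * (p : ℝ) ^ 2 * M / (b - a) * δ = M / 2 := by
    rw [hδ]; field_simp; norm_num
  have hlow : ∀ y ∈ Set.Icc a b, |y - x₀| ≤ δ → M / 2 ≤ |φ.eval y| := by
    intro y hy hyd
    have h1 := (convex_Icc a b).norm_image_sub_le_of_norm_hasDerivWithin_le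
      (f := fun x => φ.eval x) (f' := fun x => φ.derivative.eval x)
      (fun x _ => (φ.hasDerivAt x).hasDerivWithinAt) hder hx₀ hy
    simp only [Real.norm_eq_abs] at h1
    have h2 : 4 * (p : ℝ) ^ 2 * M / (b - a) * |y - x₀| ≤ M / 2 := by
      rw [← hKδ]; gcongr
    have h3 := abs_sub_abs_le_abs_sub (φ.eval x₀) (φ.eval y)
    rw [abs_sub_comm] at h3
    linarith
  obtain ⟨u, hau, hub, hu⟩ : ∃ u, a ≤ u ∧ u + δ ≤ b ∧
      ∀ y ∈ Set.Icc u (u + δ), |y - x₀| ≤ δ := by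
    rcases le_total ((a + b) / 2) x₀ with h | h
    · refine ⟨x₀ - δ, by linarith, by linarith [hx₀.2], fun y hy => ?_⟩
      rw [abs_le]; constructor <;> linarith [hy.1, hy.2]
    · refine ⟨x₀, hx₀.1, by linarith, fun y hy => ?_⟩
      rw [abs_le]; constructor <;> linarith [hy.1, hy.2]
  have hcq : Continuous (fun x => |φ.eval x| ^ q) :=
    hcont.rpow_const (fun _ => Or.inr hq0.le)
  have hI : δ * (M / 2) ^ q ≤ ∫ x in a..b, |φ.eval x| ^ q := by
    calc δ * (M / 2) ^ q = ∫ x in u..(u + δ), (M / 2) ^ q := by simp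
      _ ≤ ∫ x in u..(u + δ), |φ.eval x| ^ q := by
        apply intervalIntegral.integral_mono_on (by linarith)
          (continuous_const.intervalIntegrable _ _) (hcq.intervalIntegrable _ _)
        intro y hy
        have := hlow y ⟨hau.trans hy.1, hy.2.trans hub⟩ (hu y hy)
        gcongr
      _ ≤ ∫ x in a..b, |φ.eval x| ^ q := by
        apply intervalIntegral.integral_mono_interval hau (by linarith) hub
        · exact Filter.Eventually.of_forall (fun x => by positivity)
        · exact hcq.intervalIntegrable _ _
  have hpq : (p : ℝ) ^ (2 / q) = ((p : ℝ) ^ 2) ^ (1 / q) := by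
    rw [← Real.rpow_natCast, ← Real.rpow_mul (by positivity)]
    congr 1; push_cast; ring
  have hprod : 2 * (8 / (b - a)) ^ (1 / q) * (p : ℝ) ^ (2 / q) *
        (∫ x in a..b, |φ.eval x| ^ q) ^ (1 / q)
      = 2 * (δ⁻¹ * ∫ x in a..b, |φ.eval x| ^ q) ^ (1 / q) := by
    rw [hpq, mul_assoc, mul_assoc, ← Real.mul_rpow (by positivity) hint0,
      ← Real.mul_rpow (by positivity) (by positivity)]
    congr 2
    rw [hδ]; field_simp
  rw [hprod]
  have h4 : (M / 2) ^ q ≤ δ⁻¹ * ∫ x in a..b, |φ.eval x| ^ q := by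
    rw [← div_eq_inv_mul, le_div_iff₀ hδ0]; linarith
  have h5 : M / 2 ≤ (δ⁻¹ * ∫ x in a..b, |φ.eval x| ^ q) ^ (1 / q) := by
    calc M / 2 = ((M / 2) ^ q) ^ (1 / q) := by
          rw [← Real.rpow_mul (by positivity), mul_one_div_cancel hq0.ne', Real.rpow_one]
      _ ≤ _ := by gcongr
  linarith
end
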